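/- arXiv:1404.1047 — 9 statements merged into one kernel-verified Lean document; each statement's English description precedes it below -/
import Mathlib

section
/- Let F be a perfect field of characteristic 2, let H be the Heisenberg Lie algebra over F with basis x1, x2, x3 and [x1,x2] = x3, and for ξ ∈ F let φ_ξ be the unique [2]-map on H with φ_ξ(x1) = x3, φ_ξ(x2) = ξ·x3 and φ_ξ(x3) = 0. Then for ξ1, ξ2 ∈ F there exists a Lie algebra automorphism A of H with A(φ_{ξ1}(v)) = φ_{ξ2}(A(v)) for all v ∈ H if and only if ξ1 + ξ2 ∈ K, where K = {δ + δ² : δ ∈ F} is the Artin–Schreier subset of F. -/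
/-- The bracket of the Heisenberg Lie algebra on `Fin 3 → F`, determined by
`[x1,x2] = x3`, `[x1,x3] = [x2,x3] = 0` on the standard basis. -/
def heisBr {F : Type*} [Field F] (u v : Fin 3 → F) : Fin 3 → F :=
  ![0, 0, u 0 * v 1 - u 1 * v 0]

/-- A `[2]`-map on the Heisenberg algebra with `φ x1 = x3`, `φ x2 = ξ • x3`, `φ x3 = 0` is the
quadratic form `a² + a b + ξ b²` with values in the center. -/
theorem heisenberg_twoMap_eq {F : Type*} [Field F] (ξ : F) (φ : (Fin 3 → F) → (Fin 3 → F))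
    (hsmul : ∀ (c : F) (v : Fin 3 → F), φ (c • v) = c ^ 2 • φ v)
    (hadd : ∀ u v, φ (u + v) = φ u + φ v + heisBr u v)
    (hx1 : φ ![1, 0, 0] = ![0, 0, 1])
    (hx2 : φ ![0, 1, 0] = ξ • ![0, 0, 1])
    (hx3 : φ ![0, 0, 1] = 0) (v : Fin 3 → F) :
    φ v = ![0, 0, v 0 ^ 2 + v 0 * v 1 + ξ * v 1 ^ 2] := by
  have hv : v = v 0 • ![1, 0, 0] + v 1 • ![0, 1, 0] + v 2 • ![0, 0, 1] := by
    ext i; fin_cases i <;> simp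
  have key : φ (v 0 • ![1, 0, 0] + v 1 • ![0, 1, 0] + v 2 • ![0, 0, 1]) =
      ![0, 0, v 0 ^ 2 + v 0 * v 1 + ξ * v 1 ^ 2] := by
    rw [hadd, hadd, hsmul, hsmul, hsmul, hx1, hx2, hx3]
    ext i
    fin_cases i <;> simp [heisBr]
    ring
  rwa [← hv] at key

/-- The shear `x1 ↦ x1`, `x2 ↦ δ x1 + x2`, `x3 ↦ x3` of the Heisenberg algebra. -/
def heisenbergShear {F : Type*} [Field F] (δ : F) : (Fin 3 → F) ≃ₗ[F] (Fin 3 → F) where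
  toFun v := ![v 0 + δ * v 1, v 1, v 2]
  invFun v := ![v 0 - δ * v 1, v 1, v 2]
  map_add' u v := by
    ext i; fin_cases i <;> simp
    ring
  map_smul' c v := by
    ext i; fin_cases i <;> simp
    ring
  left_inv v := by ext i; fin_cases i <;> simp
  right_inv v := by ext i; fin_cases i <;> simp

theorem heisenbergShear_apply {F : Type*} [Field F] (δ : F) (v : Fin 3 → F) :
    heisenbergShear δ v = ![v 0 + δ * v 1, v 1, v 2] := rfl

/-- Two binary quadratic forms `a² + a b + ξ b²` in characteristic 2 that are related by a
substitution of determinant `d` scaling the form by `d` have the same Arf invariant. -/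
theorem exists_artinSchreier_of_similitude {F : Type*} [Field F] [CharP F 2]
    {ξ₁ ξ₂ a b c e d : F} (hd : d ≠ 0) (hdet : d = a * e - b * c)
    (h1 : a ^ 2 + a * b + ξ₂ * b ^ 2 = d) (h2 : c ^ 2 + c * e + ξ₂ * e ^ 2 = d * ξ₁) :
    ∃ δ : F, ξ₁ + ξ₂ = δ + δ ^ 2 := by
  have two : (2 : F) = 0 := CharTwo.two_eq_zero
  refine ⟨(a * c + b * c + b * e * ξ₂) / d, ?_⟩
  have key : (ξ₁ + ξ₂) * d ^ 2 =
      (a * c + b * c + b * e * ξ₂) * d + (a * c + b * c + b * e * ξ₂) ^ 2 := by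
    have hprod : d ^ 2 * ξ₁ =
        (a ^ 2 + a * b + ξ₂ * b ^ 2) * (c ^ 2 + c * e + ξ₂ * e ^ 2) := by
      rw [h1, h2]; ring
    have hexp : (ξ₁ + ξ₂) * d ^ 2 = d ^ 2 * ξ₁ + ξ₂ * d ^ 2 := by ring
    rw [hexp, hprod, hdet]
    grind
  field_simp
  linear_combination key

/-- Two `[2]`-maps `φ_{ξ1}`, `φ_{ξ2}` on the Heisenberg Lie algebra over a perfect
field of characteristic 2 (with `φ_ξ x1 = x3`, `φ_ξ x2 = ξ • x3`, `φ_ξ x3 = 0`) are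
conjugate under a Lie algebra automorphism if and only if `ξ1 + ξ2` lies in the
Artin--Schreier subset `{δ + δ² : δ ∈ F}`. -/
theorem heisenberg_char2_iso_iff_artinSchreier
    (F : Type*) [Field F] [CharP F 2]
    (hperf : Function.Surjective fun c : F => c ^ 2)
    (ξ₁ ξ₂ : F)
    (φ₁ φ₂ : (Fin 3 → F) → (Fin 3 → F))
    (h₁cen : ∀ v, φ₁ v ∈ Submodule.span F ({![0, 0, 1]} : Set (Fin 3 → F)))
    (h₁smul : ∀ (c : F) (v : Fin 3 → F), φ₁ (c • v) = c ^ 2 • φ₁ v)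
    (h₁add : ∀ u v, φ₁ (u + v) = φ₁ u + φ₁ v + heisBr u v)
    (h₁x1 : φ₁ ![1, 0, 0] = ![0, 0, 1])
    (h₁x2 : φ₁ ![0, 1, 0] = ξ₁ • ![0, 0, 1])
    (h₁x3 : φ₁ ![0, 0, 1] = 0)
    (h₂cen : ∀ v, φ₂ v ∈ Submodule.span F ({![0, 0, 1]} : Set (Fin 3 → F)))
    (h₂smul : ∀ (c : F) (v : Fin 3 → F), φ₂ (c • v) = c ^ 2 • φ₂ v)
    (h₂add : ∀ u v, φ₂ (u + v) = φ₂ u + φ₂ v + heisBr u v)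
    (h₂x1 : φ₂ ![1, 0, 0] = ![0, 0, 1])
    (h₂x2 : φ₂ ![0, 1, 0] = ξ₂ • ![0, 0, 1])
    (h₂x3 : φ₂ ![0, 0, 1] = 0) :
    (∃ A : (Fin 3 → F) ≃ₗ[F] (Fin 3 → F),
        (∀ u v, A (heisBr u v) = heisBr (A u) (A v)) ∧ ∀ v, A (φ₁ v) = φ₂ (A v)) ↔
      ∃ δ : F, ξ₁ + ξ₂ = δ + δ ^ 2 := by
  have e₁ := heisenberg_twoMap_eq ξ₁ φ₁ h₁smul h₁add h₁x1 h₁x2 h₁x3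
  have e₂ := heisenberg_twoMap_eq ξ₂ φ₂ h₂smul h₂add h₂x1 h₂x2 h₂x3
  constructor
  · rintro ⟨A, hbr, hA⟩
    set d := A ![1, 0, 0] 0 * A ![0, 1, 0] 1 - A ![1, 0, 0] 1 * A ![0, 1, 0] 0 with hdet
    have hx3 : A ![0, 0, 1] = ![0, 0, d] := by
      have := hbr ![1, 0, 0] ![0, 1, 0]
      simpa [heisBr] using this
    have hd : d ≠ 0 := by
      intro h
      have hzero : A ![0, 0, 1] = 0 := by
        rw [hx3, h]; ext i; fin_cases i <;> rfl
      have := congrFun ((map_eq_zero_iff A A.injective).mp hzero) 2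
      simp at this
    refine exists_artinSchreier_of_similitude hd hdet ?_ ?_
    · have := hA ![1, 0, 0]
      rw [h₁x1, hx3, e₂] at this
      simpa using (congrFun this 2).symm
    · have := hA ![0, 1, 0]
      rw [h₁x2, map_smul, hx3, e₂] at this
      simpa [mul_comm] using (congrFun this 2).symm
  · rintro ⟨δ, hδ⟩
    have two : (2 : F) = 0 := CharTwo.two_eq_zero
    refine ⟨heisenbergShear δ, fun u v => ?_, fun v => ?_⟩
    · ext i
      fin_cases i <;> simp [heisenbergShear_apply, heisBr]
      ring
    · rw [e₁, e₂]
      ext i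
      fin_cases i <;> simp [heisenbergShear_apply]
      linear_combination v 1 ^ 2 * hδ - (v 1 ^ 2 * ξ₂ + δ * v 0 * v 1) * two
end

section
/- Let F be a perfect field of characteristic p ≥ 5 and let L be the 4-dimensional Lie algebra over F with basis x1, x2, x3, x4 and bracket determined by [x1,x2] = x3 and [x1,x3] = x4, all other brackets of basis vectors being zero. For β ∈ F∖{0} let φ_β be the p-semilinear map L → Z(L) with φ_β(x2) = β·x4 and φ_β(x1) = φ_β(x3) = φ_β(x4) = 0. Then for β1, β2 ∈ F∖{0} there exists a Lie algebra automorphism A of L with A ∘ φ_{β1} = φ_{β2} ∘ A if and only if β1·β2^{-1} is a square in F. -/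
/-- The bracket of the Lie algebra `L_{4,3}` on `Fin 4 → F`, determined by
`[x1,x2] = x3`, `[x1,x3] = x4`, all other brackets of standard basis vectors zero. -/
def br43 {F : Type*} [Field F] (u v : Fin 4 → F) : Fin 4 → F :=
  ![0, 0, u 0 * v 1 - u 1 * v 0, u 0 * v 2 - u 2 * v 0]

/-- An additive map that is homogeneous of degree `p` and sends `x2` to `β x4` and the other
basis vectors to zero is given in coordinates by `v ↦ β v₂ ^ p x4`. -/
theorem semilinear_eq_smul_x4 {F : Type*} [Field F] {p : ℕ} {β : F}
    {φ : (Fin 4 → F) → (Fin 4 → F)}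
    (hadd : ∀ u v, φ (u + v) = φ u + φ v)
    (hsmul : ∀ (c : F) (v : Fin 4 → F), φ (c • v) = c ^ p • φ v)
    (hx1 : φ ![1, 0, 0, 0] = 0) (hx2 : φ ![0, 1, 0, 0] = β • ![0, 0, 0, 1])
    (hx3 : φ ![0, 0, 1, 0] = 0) (hx4 : φ ![0, 0, 0, 1] = 0) (v : Fin 4 → F) :
    φ v = (β * v 1 ^ p) • ![0, 0, 0, 1] := by
  have hv : v = v 0 • ![1, 0, 0, 0] + v 1 • ![0, 1, 0, 0] + v 2 • ![0, 0, 1, 0]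
      + v 3 • ![0, 0, 0, 1] := by
    ext i
    fin_cases i <;> simp
  conv_lhs => rw [hv]
  simp only [hadd, hsmul, hx1, hx2, hx3, hx4, smul_zero, zero_add, add_zero, smul_smul]
  rw [mul_comm]

/-- A Lie algebra automorphism of `L_{4,3}` sends `x2` into the span of `x2`, `x3`, `x4`, and
multiplies `x4` by `a² b`, where `a` and `b` are its first two diagonal entries. -/
theorem br43_automorphism_x2_x4 {F : Type*} [Field F]
    (A : (Fin 4 → F) ≃ₗ[F] (Fin 4 → F)) (hA : ∀ u v, A (br43 u v) = br43 (A u) (A v)) :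
    A ![0, 1, 0, 0] 0 = 0 ∧
      A ![0, 0, 0, 1] = (A ![1, 0, 0, 0] 0 ^ 2 * A ![0, 1, 0, 0] 1) • ![0, 0, 0, 1] := by
  have h12 := hA ![1, 0, 0, 0] ![0, 1, 0, 0]
  have h13 := hA ![1, 0, 0, 0] ![0, 0, 1, 0]
  have h23 := hA ![0, 1, 0, 0] ![0, 0, 1, 0]
  rw [show br43 (F := F) ![1, 0, 0, 0] ![0, 1, 0, 0] = ![0, 0, 1, 0] by simp [br43]] at h12
  rw [show br43 (F := F) ![1, 0, 0, 0] ![0, 0, 1, 0] = ![0, 0, 0, 1] by simp [br43], h12] at h13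
  rw [show br43 (F := F) ![0, 1, 0, 0] ![0, 0, 1, 0] = 0 by ext i; fin_cases i <;> simp [br43],
    map_zero, h12] at h23
  have hx4 : A ![0, 0, 0, 1] ≠ 0 := by
    rw [Ne, LinearEquiv.map_eq_zero_iff]
    exact fun h => one_ne_zero (congrFun h 3)
  generalize A ![1, 0, 0, 0] = a at *
  generalize A ![0, 1, 0, 0] = b at *
  have hD : a 0 * b 1 - a 1 * b 0 ≠ 0 := fun hD => hx4 <| by
    rw [h13]
    ext i
    fin_cases i <;> simp [br43, hD]
  have hb : b 0 = 0 := by simpa [br43, hD] using congrFun h23 3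
  refine ⟨hb, h13.trans ?_⟩
  ext i
  fin_cases i <;> simp [br43, hb]
  ring

/-- The restricted structures `φ_{β1}`, `φ_{β2}` on `L_{4,3}` (with
`φ_β x2 = β • x4` and `φ_β x1 = φ_β x3 = φ_β x4 = 0`) are conjugate under a Lie
algebra automorphism if and only if `β1 β2⁻¹` is a square in `F`. -/
theorem l43_beta_iso_iff_square
    (F : Type*) [Field F] (p : ℕ) [CharP F p] (hp5 : 5 ≤ p)
    (hperf : Function.Surjective fun c : F => c ^ p)
    (β₁ β₂ : F) (hβ₁ : β₁ ≠ 0) (hβ₂ : β₂ ≠ 0)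
    (φ₁ φ₂ : (Fin 4 → F) → (Fin 4 → F))
    (h₁add : ∀ u v, φ₁ (u + v) = φ₁ u + φ₁ v)
    (h₁smul : ∀ (c : F) (v : Fin 4 → F), φ₁ (c • v) = c ^ p • φ₁ v)
    (h₁cen : ∀ v, φ₁ v ∈ Submodule.span F ({![0, 0, 0, 1]} : Set (Fin 4 → F)))
    (h₁x1 : φ₁ ![1, 0, 0, 0] = 0)
    (h₁x2 : φ₁ ![0, 1, 0, 0] = β₁ • ![0, 0, 0, 1])
    (h₁x3 : φ₁ ![0, 0, 1, 0] = 0)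
    (h₁x4 : φ₁ ![0, 0, 0, 1] = 0)
    (h₂add : ∀ u v, φ₂ (u + v) = φ₂ u + φ₂ v)
    (h₂smul : ∀ (c : F) (v : Fin 4 → F), φ₂ (c • v) = c ^ p • φ₂ v)
    (h₂cen : ∀ v, φ₂ v ∈ Submodule.span F ({![0, 0, 0, 1]} : Set (Fin 4 → F)))
    (h₂x1 : φ₂ ![1, 0, 0, 0] = 0)
    (h₂x2 : φ₂ ![0, 1, 0, 0] = β₂ • ![0, 0, 0, 1])
    (h₂x3 : φ₂ ![0, 0, 1, 0] = 0)
    (h₂x4 : φ₂ ![0, 0, 0, 1] = 0) :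
    (∃ A : (Fin 4 → F) ≃ₗ[F] (Fin 4 → F),
        (∀ u v, A (br43 u v) = br43 (A u) (A v)) ∧ ∀ v, A (φ₁ v) = φ₂ (A v)) ↔
      ∃ c : F, β₁ * β₂⁻¹ = c ^ 2 := by
  have hφ₁ := semilinear_eq_smul_x4 h₁add h₁smul h₁x1 h₁x2 h₁x3 h₁x4
  have hφ₂ := semilinear_eq_smul_x4 h₂add h₂smul h₂x1 h₂x2 h₂x3 h₂x4
  have hp : p.Prime := (CharP.char_is_prime_or_zero F p).resolve_right (by omega)
  obtain ⟨k, hk⟩ := hp.odd_of_ne_two (by omega)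
  constructor
  · rintro ⟨A, hA, hAφ⟩
    obtain ⟨hb0, hx4⟩ := br43_automorphism_x2_x4 A hA
    have hne : A ![0, 0, 0, 1] ≠ 0 := by
      rw [Ne, LinearEquiv.map_eq_zero_iff]
      exact fun h => one_ne_zero (congrFun h 3)
    have h := hAφ ![0, 1, 0, 0]
    rw [h₁x2, map_smul, hφ₂, hx4] at h
    rw [hx4] at hne
    generalize A ![1, 0, 0, 0] 0 = a at *
    generalize A ![0, 1, 0, 0] 1 = b at *
    have ha : a ≠ 0 := by
      rintro rfl
      simp at hne
    have hb : b ≠ 0 := by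
      rintro rfl
      simp at hne
    have h3 : β₁ * (a ^ 2 * b) = β₂ * b ^ p := by simpa using congrFun h 3
    refine ⟨b ^ k / a, ?_⟩
    field_simp
    apply mul_right_cancel₀ hb
    rw [hk] at h3
    linear_combination h3
  · rintro ⟨c, hc⟩
    have hc0 : c ≠ 0 := by
      rintro rfl
      simp [hβ₁, hβ₂] at hc
    have hβ : β₁ = c ^ 2 * β₂ := by rw [← hc, inv_mul_cancel_right₀ hβ₂]
    have hd : ∀ i, (![c⁻¹, 1, c⁻¹, (c ^ 2)⁻¹] : Fin 4 → F) i ≠ 0 := by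
      intro i
      fin_cases i <;> simp [hc0]
    let A : (Fin 4 → F) ≃ₗ[F] (Fin 4 → F) :=
      LinearEquiv.piCongrRight fun i => LinearEquiv.smulOfNeZero F F _ (hd i)
    have hAv : ∀ v i, A v i = (![c⁻¹, 1, c⁻¹, (c ^ 2)⁻¹] : Fin 4 → F) i * v i := fun _ _ => rfl
    refine ⟨A, fun u v => ?_, fun v => ?_⟩
    · ext i
      fin_cases i <;> simp [hAv, br43] <;> field_simp
    · rw [hφ₁, hφ₂]
      ext i
      fin_cases i <;> simp [hAv, hβ]
      field_simp
end

section
/- Let F be a perfect field of characteristic 3. Define a relation ~ on F³ by: (α,β,γ) ~ (α',β',γ') if and only if there exist a11, a22 ∈ F∖{0} and a12, a13, a23 ∈ F such that α' = (a11²a22)^{-1}·(a11³α + a12³β + a13³γ + a11²a12), β' = (a11²a22)^{-1}·(a22³β + a23³γ), and γ' = a11·a22²·γ. Then: (i) every triple (α,β,γ) with γ ≠ 0 satisfies (α,β,γ) ~ (0,0,1); (ii) (α,0,0) ~ (0,0,0) for every α ∈ F; (iii) no triple of the form (α,β,0) is related to a triple with nonzero last coordinate, and no triple of the form (α,β,0)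 with β ≠ 0 is related to a triple of the form (α',0,0). -/
/-- The orbit relation on triples `(α, β, γ) ∈ F³` parametrizing the `[3]`-maps on
`L_{4,3}` in characteristic 3, induced by the automorphism group of `L_{4,3}`. -/
def rel43char3 {F : Type*} [Field F] (v w : F × F × F) : Prop :=
  ∃ a11 a22 a12 a13 a23 : F, a11 ≠ 0 ∧ a22 ≠ 0 ∧
    w.1 = (a11 ^ 2 * a22)⁻¹ *
        (a11 ^ 3 * v.1 + a12 ^ 3 * v.2.1 + a13 ^ 3 * v.2.2 + a11 ^ 2 * a12) ∧
    w.2.1 = (a11 ^ 2 * a22)⁻¹ * (a22 ^ 3 * v.2.1 + a23 ^ 3 * v.2.2) ∧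
    w.2.2 = a11 * a22 ^ 2 * v.2.2

/-- Orbits of the parameters of `[3]`-maps on `L_{4,3}` over a perfect field of
characteristic 3: triples with `γ ≠ 0` are equivalent to `(0,0,1)`, triples
`(α,0,0)` are equivalent to `(0,0,0)`, and these classes do not mix with the
triples `(α,β,0)`, `β ≠ 0`. -/
theorem l43_char3_orbits
    (F : Type*) [Field F] [CharP F 3]
    (hperf : Function.Surjective fun c : F => c ^ 3) :
    (∀ α β γ : F, γ ≠ 0 → rel43char3 (α, β, γ) (0, 0, 1)) ∧
      (∀ α : F, rel43char3 (α, (0 : F), (0 : F)) (0, 0, 0)) ∧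
      (∀ α β α' β' γ' : F, γ' ≠ 0 → ¬ rel43char3 (α, β, 0) (α', β', γ')) ∧
      (∀ α β α' : F, β ≠ 0 → ¬ rel43char3 (α, β, 0) (α', 0, 0)) := by
  refine ⟨fun α β γ hγ => ?_, fun α => ?_, ?_, ?_⟩
  · obtain ⟨a13, h13⟩ := hperf (-(γ⁻¹ ^ 3 * α) / γ)
    obtain ⟨a23, h23⟩ := hperf (-β / γ)
    dsimp only at h13 h23
    refine ⟨γ⁻¹, 1, 0, a13, a23, inv_ne_zero hγ, one_ne_zero, ?_, ?_, ?_⟩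
    · simp [h13, hγ]
    · simp [h23, hγ]
    · simp [hγ]
  · exact ⟨1, 1, -α, 0, 0, one_ne_zero, one_ne_zero, by simp, by simp, by simp⟩
  · rintro α β α' β' γ' hγ' ⟨a11, a22, a12, a13, a23, -, -, -, -, h⟩
    exact hγ' (by simpa using h)
  · rintro α β α' hβ ⟨a11, a22, a12, a13, a23, h11, h22, -, h, -⟩
    simp [h11, h22, hβ] at h
end

section
/- Let F be a perfect field of characteristic 3. Define a relation ~ on F³ by: (α,β,γ) ~ (α',β',γ') if and only if there exist a11, a22 ∈ F∖{0} and a12, a13, a23 ∈ F such that α' = (a11²a22)^{-1}·(a11³α + a12³β + a13³γ + a11²a12), β' = (a11²a22)^{-1}·(a22³β + a23³γ), and γ' = a11·a22²·γ. For β ∈ F∖{0} set K_β = {β·δ³ + δ : δ ∈ F}. Then for α1, α2 ∈ F and β1, β2 ∈ F∖{0}, we have (α1,β1,0) ~ (α2,β2,0) if and only if there exists ε ∈ F with ε² = β2·β1^{-1} and either α1 + α2·ε ∈ K_{β1} or α1 − α2·ε ∈ K_{β1}. -/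
/-- Criterion for two parameter triples `(α1, β1, 0)`, `(α2, β2, 0)` with
`β1, β2 ≠ 0` to give isomorphic restricted Lie algebra structures on `L_{4,3}` over
a perfect field of characteristic 3: `β2 β1⁻¹` must be a square `ε²`, and
`α1 + α2 ε` or `α1 - α2 ε` must lie in `K_{β1} = {β1 δ³ + δ : δ ∈ F}`. -/
theorem l43_char3_iso_criterion
    (F : Type*) [Field F] [CharP F 3]
    (hperf : Function.Surjective fun c : F => c ^ 3)
    (α₁ α₂ β₁ β₂ : F) (hβ₁ : β₁ ≠ 0) (hβ₂ : β₂ ≠ 0) :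
    rel43char3 (α₁, β₁, (0 : F)) (α₂, β₂, (0 : F)) ↔
      ∃ ε : F, ε ^ 2 = β₂ * β₁⁻¹ ∧
        ((∃ δ : F, α₁ + α₂ * ε = β₁ * δ ^ 3 + δ) ∨
          (∃ δ : F, α₁ - α₂ * ε = β₁ * δ ^ 3 + δ)) := by
  have h_of : ∀ ε δ : F, ε ^ 2 = β₂ * β₁⁻¹ → α₁ - α₂ * ε = β₁ * δ ^ 3 + δ →
      rel43char3 (α₁, β₁, (0 : F)) (α₂, β₂, (0 : F)) := by
    intro ε δ hε hδ
    have hε₀ : ε ≠ 0 := by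
      rintro rfl
      exact mul_ne_zero hβ₂ (inv_ne_zero hβ₁) (by simpa using hε.symm)
    have hβ : ε ^ 2 * β₁ = β₂ := by rw [hε, inv_mul_cancel_right₀ hβ₁]
    refine ⟨1, ε, -δ, 0, 0, one_ne_zero, hε₀, ?_, ?_, ?_⟩
    · field_simp
      linear_combination -hδ
    · field_simp
      linear_combination -ε * hβ
    · simp
  constructor
  · rintro ⟨a, b, c, d, e, ha, hb, h₁, h₂, -⟩
    dsimp only at h₁ h₂
    refine ⟨b / a, ?_, Or.inr ⟨-(c / a), ?_⟩⟩
    · rw [h₂]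
      field_simp
      ring
    · rw [h₁]
      field_simp
      ring
  · rintro ⟨ε, hε, ⟨δ, hδ⟩ | ⟨δ, hδ⟩⟩
    · exact h_of (-ε) δ (by rw [neg_sq, hε]) (by rw [← hδ]; ring)
    · exact h_of ε δ hε hδ
end

section
/- Let F be a field of characteristic 2 and let L be the 4-dimensional Lie algebra over F with basis x1, x2, x3, x4 and bracket determined by [x1,x2] = x3 and [x1,x3] = x4, all other brackets of basis vectors being zero. Then for every y ∈ L the linear map ad y : L → L, z ↦ [y,z], is different from (ad x1)² = (ad x1) ∘ (ad x1). Consequently there is no map φ : L → L satisfying ad(φ(y)) = (ad y)² for all y ∈ L; that is, L admits no restricted Lie algebra structure in characteristic 2. -/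
/-- No adjoint map of `L_{4,3}` is the square of `ad x1`: they differ at `x2`. -/
theorem ad_ne_ad_sq_br43 {F : Type*} [Field F] (y : Fin 4 → F) :
    (fun z => br43 y z) ≠ fun z : Fin 4 → F => br43 ![1, 0, 0, 0] (br43 ![1, 0, 0, 0] z) := by
  intro h
  have h₂ := congrFun (congrFun h ![0, 1, 0, 0]) 3
  simp [br43] at h₂

/-- Over a field of characteristic 2, no adjoint map of `L_{4,3}` equals
`(ad x1)²`; consequently `L_{4,3}` admits no restricted Lie algebra structure in
characteristic 2. -/
theorem l43_char2_not_restrictable (F : Type*) [Field F] [CharP F 2] :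
    (∀ y : Fin 4 → F,
        (fun z => br43 y z) ≠ fun z : Fin 4 → F => br43 ![1, 0, 0, 0] (br43 ![1, 0, 0, 0] z)) ∧
      ¬ ∃ φ : (Fin 4 → F) → (Fin 4 → F),
          ∀ y z : Fin 4 → F, br43 (φ y) z = br43 y (br43 y z) := by
  refine ⟨ad_ne_ad_sq_br43, ?_⟩
  rintro ⟨φ, hφ⟩
  exact ad_ne_ad_sq_br43 (φ ![1, 0, 0, 0]) (funext (hφ ![1, 0, 0, 0]))
end

section
/- Let F be a perfect field of characteristic p > 0, let V be a 2-dimensional vector space over F with basis (x3, x4), and let ψ : V → V be a nilpotent p-semilinear map. Then there exist d, b ∈ F∖{0} and a ∈ F such that, setting x3' = d·x3 and x4' = a·x3 + b·x4, exactly one of the following holds: (i) ψ(x3') = ψ(x4') = 0; (ii) ψ(x3') = x4' and ψ(x4') = 0; (iii) ψ(x3') = 0 and ψ(x4') = x3'. Case (i) occurs if and only if ψ = 0, case (ii) occurs if and only if ψ(x3) ≠ 0, and case (iii) occurs if and only if ψ(x3) = 0 and ψ ≠ 0. (This describes the possible restrictions of a [p]-nilpotent [p]-map of L_{4,2} to its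 center, up to automorphisms of L_{4,2}, which act on the center by base changes of the given form.) -/
/-- A pointwise nilpotent map preserving `P` and satisfying `P` somewhere satisfies `P` at `0`. -/
theorem invariant_zero_of_iterate_eq_zero {V : Type*} [Zero V] {ψ : V → V} {n : ℕ}
    (hnil : ∀ v, ψ^[n] v = 0) (P : V → Prop) (hP : ∀ v, P v → P (ψ v)) {v : V} (hv : P v) :
    P 0 := by
  have key : ∀ m, P (ψ^[m] v) := fun m => by
    induction m with
    | zero => exact hv
    | succ k ih => rw [Function.iterate_succ_apply']; exact hP _ ih
  exact hnil v ▸ key n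

/-- A nilpotent semilinear map has no nonzero eigenvalue. -/
theorem eigenvalue_eq_zero_of_iterate_eq_zero {F V : Type*} [Field F] [AddCommGroup V] [Module F V]
    {p : ℕ} {ψ : V → V} (hsmul : ∀ (c : F) (v : V), ψ (c • v) = c ^ p • ψ v) {n : ℕ}
    (hnil : ∀ v, ψ^[n] v = 0) {c : F} {v : V} (hv : v ≠ 0) (h : ψ v = c • v) : c = 0 := by
  by_contra hc
  obtain ⟨k, hk, h0⟩ := invariant_zero_of_iterate_eq_zero hnil (fun w => ∃ k : F, k ≠ 0 ∧ w = k • v)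
    (by
      rintro _ ⟨k, hk, rfl⟩
      exact ⟨k ^ p * c, mul_ne_zero (pow_ne_zero _ hk) hc, by rw [hsmul, h, smul_smul]⟩)
    ⟨1, one_ne_zero, (one_smul F v).symm⟩
  exact smul_ne_zero hk hv h0.symm

/-- Classification of the possible restrictions of a `[p]`-nilpotent `[p]`-map of
`L_{4,2}` to its 2-dimensional center, up to base changes preserving `span(x3)`. -/
theorem center_restriction_classification
    (F : Type*) [Field F] (p : ℕ) [CharP F p] (hp : 0 < p)
    (hperf : Function.Surjective fun c : F => c ^ p)
    (ψ : (Fin 2 → F) → (Fin 2 → F))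
    (hadd : ∀ u v, ψ (u + v) = ψ u + ψ v)
    (hsmul : ∀ (c : F) (v : Fin 2 → F), ψ (c • v) = c ^ p • ψ v)
    (hnil : ∃ n : ℕ, 0 < n ∧ ∀ v, ψ^[n] v = 0) :
    ∃ d b a : F, d ≠ 0 ∧ b ≠ 0 ∧
      (let x3 : Fin 2 → F := ![1, 0]
       let x4 : Fin 2 → F := ![0, 1]
       let x3' := d • x3
       let x4' := a • x3 + b • x4
       ((ψ x3' = 0 ∧ ψ x4' = 0) ∨ (ψ x3' = x4' ∧ ψ x4' = 0) ∨
          (ψ x3' = 0 ∧ ψ x4' = x3')) ∧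
         ((ψ x3' = 0 ∧ ψ x4' = 0) ↔ ∀ v, ψ v = 0) ∧
         ((ψ x3' = x4' ∧ ψ x4' = 0) ↔ ψ x3 ≠ 0) ∧
         ((ψ x3' = 0 ∧ ψ x4' = x3') ↔ (ψ x3 = 0 ∧ ¬ ∀ v, ψ v = 0))) := by
  obtain ⟨n, -, hn⟩ := hnil
  have hp0 : p ≠ 0 := hp.ne'
  have hψ0 : ψ 0 = 0 := by simpa using hadd 0 0
  have hx3 : (![1, 0] : Fin 2 → F) ≠ 0 := fun h => one_ne_zero (congrFun h 0)
  have hdecomp : ∀ v : Fin 2 → F, v = v 0 • ![1, 0] + v 1 • ![0, 1] := fun v => by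
    ext i; fin_cases i <;> simp
  have hψ : ∀ v, ψ v = v 0 ^ p • ψ ![1, 0] + v 1 ^ p • ψ ![0, 1] := fun v => by
    conv_lhs => rw [hdecomp v]
    rw [hadd, hsmul, hsmul]
  by_cases h3 : ψ ![1, 0] = 0
  · by_cases hz : ∀ v, ψ v = 0
    · refine ⟨1, 1, 0, one_ne_zero, one_ne_zero, ?_⟩
      simp [hz, eq_comm (a := (0 : Fin 2 → F))]
    · have h4 : ψ ![0, 1] ≠ 0 := fun h4 => hz fun v => by rw [hψ, h3, h4]; simp
      have hδ : ψ ![0, 1] 1 = 0 := by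
        refine pow_eq_zero_iff hp0 |>.1
          (eigenvalue_eq_zero_of_iterate_eq_zero hsmul hn h4 (c := ψ ![0, 1] 1 ^ p) ?_)
        rw [hψ (ψ ![0, 1]), h3, smul_zero, zero_add]
      have h4e : ψ ![0, 1] = ψ ![0, 1] 0 • ![1, 0] := by
        conv_lhs => rw [hdecomp (ψ ![0, 1]), hδ, zero_smul, add_zero]
      have hγ : ψ ![0, 1] 0 ≠ 0 := fun h => h4 (by rw [h4e, h, zero_smul])
      refine ⟨ψ ![0, 1] 0, 1, 0, hγ, one_ne_zero, ?_⟩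
      intro x3 x4 x3' x4'
      have e3 : ψ x3' = 0 := by rw [hsmul, h3, smul_zero]
      have e4 : x4' = ![0, 1] := by simp [x4', x4]
      have e5 : ψ x4' = x3' := by rw [e4]; exact h4e
      have e6 : ψ x4' ≠ 0 := by rwa [e4]
      have e7 : x4' ≠ 0 := fun h => e6 (by rw [h, hψ0])
      exact ⟨.inr (.inr ⟨e3, e5⟩), ⟨fun h => absurd h.2 e6, fun h => absurd h hz⟩,
        ⟨fun h => absurd h.2 e6, fun h => absurd h3 h⟩, ⟨fun _ => ⟨h3, hz⟩, fun _ => ⟨e3, e5⟩⟩⟩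
  · obtain ⟨w, hw⟩ : ∃ w, ψ ![1, 0] = w := ⟨_, rfl⟩
    have hw0 : w ≠ 0 := hw ▸ h3
    have hβ : w 1 ≠ 0 := fun h => by
      have hwe : w = w 0 • ![1, 0] := by
        conv_lhs => rw [hdecomp w, h, zero_smul, add_zero]
      have := eigenvalue_eq_zero_of_iterate_eq_zero hsmul hn hx3 (hw.trans hwe)
      exact hw0 (by rw [hwe, this, zero_smul])
    have hbasis : ∀ v : Fin 2 → F, ∃ s t : F, v = s • ![1, 0] + t • w := fun v => by
      refine ⟨v 0 - v 1 / w 1 * w 0, v 1 / w 1, ?_⟩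
      ext i; fin_cases i <;> simp [hβ]
    obtain ⟨s, t, hst⟩ := hbasis (ψ w)
    have hs : s = 0 := by
      by_contra hs
      refine invariant_zero_of_iterate_eq_zero hn (· ≠ 0) (fun v hv hv0 => hv ?_) hx3 rfl
      obtain ⟨x, y, rfl⟩ := hbasis v
      rw [hadd, hsmul, hsmul, hw, hst] at hv0
      have h0 := congrFun hv0 0
      have h1 := congrFun hv0 1
      simp only [Pi.add_apply, Pi.smul_apply, smul_eq_mul, Matrix.cons_val_zero,
        Matrix.cons_val_one, Pi.zero_apply, mul_one, mul_zero, zero_add] at h0 h1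
      have hxy : x ^ p + y ^ p * t = 0 :=
        (mul_eq_zero.1 (by linear_combination h1 : (x ^ p + y ^ p * t) * w 1 = 0)).resolve_right hβ
      have hys : y ^ p * s = 0 := by linear_combination h0 - w 0 * hxy
      have hy : y = 0 := (pow_eq_zero_iff hp0).1 ((mul_eq_zero.1 hys).resolve_right hs)
      have hx : x = 0 := by
        rw [hy, zero_pow hp0, zero_mul, add_zero] at hxy
        exact (pow_eq_zero_iff hp0).1 hxy
      rw [hx, hy, zero_smul, zero_smul, add_zero]
    rw [hs, zero_smul, zero_add] at hst
    have ht : t = 0 := eigenvalue_eq_zero_of_iterate_eq_zero hsmul hn hw0 hst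
    rw [ht, zero_smul] at hst
    refine ⟨1, w 1, w 0, one_ne_zero, hβ, ?_⟩
    intro x3 x4 x3' x4'
    have e3 : x3' = ![1, 0] := one_smul F _
    have e4 : x4' = w := (hdecomp w).symm
    rw [e3, e4, hw, hst]
    have hz : ¬ ∀ v, ψ v = 0 := fun h => h3 (h _)
    exact ⟨.inr (.inl ⟨rfl, rfl⟩), ⟨fun h => absurd h.1 hw0, fun h => absurd h hz⟩,
      ⟨fun _ => hw0, fun _ => ⟨rfl, rfl⟩⟩, ⟨fun h => absurd h.1 hw0, fun h => absurd h.1 hw0⟩⟩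
end

section
/- Let F be a perfect field of characteristic p ≥ 3. Define a relation ~ on F⁴ by: (α1,α2,β1,β2) ~ (α1',α2',β1',β2') if and only if there exist a11, a12, a21, a22 ∈ F with d := a11a22 − a12a21 ≠ 0, a44 ∈ F∖{0} and a43 ∈ F such that α1' = d^{-1}(α1·a11^p + α2·a12^p) − (a43/(d·a44))·(β1·a11^p + β2·a12^p), α2' = d^{-1}(α1·a21^p + α2·a22^p) − (a43/(d·a44))·(β1·a21^p + β2·a22^p), β1' = a44^{-1}(β1·a11^p + β2·a12^p), and β2' = a44^{-1}(β1·a21^p + β2·a22^p). Then ~ is an equivalence relation (it is the orbit relation of a group action on F⁴) with exactly four equivalence classes, represented by (0,0,0,0), (1,0,0,0), (0,0,1,0) and (1,0,0,1); in particular every element of F⁴ is related to exactly one of these four tuples. -/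
/-- The orbit relation on tuples `(α1, α2, β1, β2) ∈ F⁴` parametrizing the
`p`-semilinear maps of `L_{4,2}` into its center that vanish on the center,
induced by the automorphism group of `L_{4,2}`. -/
def rel42zero {F : Type*} [Field F] (p : ℕ) (v w : F × F × F × F) : Prop :=
  ∃ a11 a12 a21 a22 a43 a44 : F,
    a11 * a22 - a12 * a21 ≠ 0 ∧ a44 ≠ 0 ∧
    w.1 = (a11 * a22 - a12 * a21)⁻¹ * (v.1 * a11 ^ p + v.2.1 * a12 ^ p) -
        a43 / ((a11 * a22 - a12 * a21) * a44) *
          (v.2.2.1 * a11 ^ p + v.2.2.2 * a12 ^ p) ∧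
    w.2.1 = (a11 * a22 - a12 * a21)⁻¹ * (v.1 * a21 ^ p + v.2.1 * a22 ^ p) -
        a43 / ((a11 * a22 - a12 * a21) * a44) *
          (v.2.2.1 * a21 ^ p + v.2.2.2 * a22 ^ p) ∧
    w.2.2.1 = a44⁻¹ * (v.2.2.1 * a11 ^ p + v.2.2.2 * a12 ^ p) ∧
    w.2.2.2 = a44⁻¹ * (v.2.2.1 * a21 ^ p + v.2.2.2 * a22 ^ p)

/-- A denominator-free description of `rel42zero`, with `c = a43 / a44`. -/
theorem rel42zero_iff {F : Type*} [Field F] (p : ℕ) (v w : F × F × F × F) :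
    rel42zero p v w ↔ ∃ a11 a12 a21 a22 c t : F,
      a11 * a22 - a12 * a21 ≠ 0 ∧ t ≠ 0 ∧
      (a11 * a22 - a12 * a21) * w.1 =
        (v.1 - c * v.2.2.1) * a11 ^ p + (v.2.1 - c * v.2.2.2) * a12 ^ p ∧
      (a11 * a22 - a12 * a21) * w.2.1 =
        (v.1 - c * v.2.2.1) * a21 ^ p + (v.2.1 - c * v.2.2.2) * a22 ^ p ∧
      t * w.2.2.1 = v.2.2.1 * a11 ^ p + v.2.2.2 * a12 ^ p ∧
      t * w.2.2.2 = v.2.2.1 * a21 ^ p + v.2.2.2 * a22 ^ p := by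
  constructor
  · rintro ⟨a11, a12, a21, a22, a43, a44, hd, ht, h1, h2, h3, h4⟩
    refine ⟨a11, a12, a21, a22, a43 / a44, a44, hd, ht, ?_, ?_, ?_, ?_⟩
    · rw [h1]
      generalize a11 * a22 - a12 * a21 = d at *
      field_simp
      ring
    · rw [h2]
      generalize a11 * a22 - a12 * a21 = d at *
      field_simp
      ring
    · rw [h3, mul_inv_cancel_left₀ ht]
    · rw [h4, mul_inv_cancel_left₀ ht]
  · rintro ⟨a11, a12, a21, a22, c, t, hd, ht, h1, h2, h3, h4⟩
    refine ⟨a11, a12, a21, a22, c * t, t, hd, ht, ?_, ?_, ?_, ?_⟩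
    · generalize a11 * a22 - a12 * a21 = d at *
      apply mul_left_cancel₀ hd
      rw [h1]
      field_simp
      ring
    · generalize a11 * a22 - a12 * a21 = d at *
      apply mul_left_cancel₀ hd
      rw [h2]
      field_simp
      ring
    · rw [← h3, inv_mul_cancel_left₀ ht]
    · rw [← h4, inv_mul_cancel_left₀ ht]

theorem rel42zero_refl {F : Type*} [Field F] {p : ℕ} (hp : p ≠ 0) (v : F × F × F × F) :
    rel42zero p v v :=
  (rel42zero_iff p v v).2 ⟨1, 0, 0, 1, 0, 1, by simp [hp]⟩

theorem rel42zero_symm {F : Type*} [Field F] {p : ℕ} [Fact p.Prime] [CharP F p]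
    {v w : F × F × F × F} (h : rel42zero p v w) : rel42zero p w v := by
  rw [rel42zero_iff] at h ⊢
  obtain ⟨a11, a12, a21, a22, c, t, hd, ht, h1, h2, h3, h4⟩ := h
  obtain ⟨v1, v2, v3, v4⟩ := v
  obtain ⟨w1, w2, w3, w4⟩ := w
  obtain ⟨d, hdef⟩ : ∃ d, d = a11 * a22 - a12 * a21 := ⟨_, rfl⟩
  simp only [← hdef] at hd h1 h2 h3 h4
  have hdp : d ^ p = a11 ^ p * a22 ^ p - a12 ^ p * a21 ^ p := by
    rw [hdef, sub_pow_char, mul_pow, mul_pow]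
  have hdp0 : d ^ p ≠ 0 := pow_ne_zero p hd
  have hneg (x : F) : (-x) ^ p = -x ^ p := by
    simpa [zero_pow (Fact.out : p.Prime).ne_zero] using sub_pow_char (0 : F) x
  have hdet : a22 / d * (a11 / d) - -a12 / d * (-a21 / d) = d⁻¹ := by
    field_simp
    linear_combination -hdef
  refine ⟨a22 / d, -a12 / d, -a21 / d, a11 / d, -(c * t / d), t⁻¹, ?_, inv_ne_zero ht, ?_⟩
  · rw [hdet]
    exact inv_ne_zero hd
  · simp only [hdet, div_pow, hneg]
    generalize a11 ^ p = A at *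
    generalize a12 ^ p = B at *
    generalize a21 ^ p = C at *
    generalize a22 ^ p = D at *
    generalize d ^ p = E at *
    refine ⟨?_, ?_, ?_, ?_⟩
    · field_simp
      linear_combination v1 * hdp - D * h1 + B * h2 - c * D * h3 + c * B * h4
    · field_simp
      linear_combination v2 * hdp + C * h1 - A * h2 + c * C * h3 - c * A * h4
    · field_simp
      linear_combination v3 * hdp - D * h3 + B * h4
    · field_simp
      linear_combination v4 * hdp + C * h3 - A * h4

theorem rel42zero_trans {F : Type*} [Field F] {p : ℕ} [Fact p.Prime] [CharP F p]
    {u v w : F × F × F × F} (h : rel42zero p u v) (h' : rel42zero p v w) :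
    rel42zero p u w := by
  rw [rel42zero_iff] at h h' ⊢
  obtain ⟨a11, a12, a21, a22, c, t, hd, ht, h1, h2, h3, h4⟩ := h
  obtain ⟨b11, b12, b21, b22, c', t', hd', ht', h1', h2', h3', h4'⟩ := h'
  obtain ⟨u1, u2, u3, u4⟩ := u
  obtain ⟨v1, v2, v3, v4⟩ := v
  obtain ⟨w1, w2, w3, w4⟩ := w
  have hdet : (b11 * a11 + b12 * a21) * (b21 * a12 + b22 * a22) -
      (b11 * a12 + b12 * a22) * (b21 * a11 + b22 * a21) =
      (a11 * a22 - a12 * a21) * (b11 * b22 - b12 * b21) := by ring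
  refine ⟨b11 * a11 + b12 * a21, b11 * a12 + b12 * a22, b21 * a11 + b22 * a21,
    b21 * a12 + b22 * a22, c + c' * (a11 * a22 - a12 * a21) / t, t * t', ?_,
    mul_ne_zero ht ht', ?_⟩
  · rw [hdet]
    exact mul_ne_zero hd hd'
  · simp only [hdet, add_pow_char, mul_pow]
    dsimp only at h1 h2 h3 h4 h1' h2' h3' h4'
    generalize a11 * a22 - a12 * a21 = d at *
    generalize b11 * b22 - b12 * b21 = d' at *
    have e3 : v3 = (u3 * a11 ^ p + u4 * a12 ^ p) / t := by rw [← h3]; field_simp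
    have e4 : v4 = (u3 * a21 ^ p + u4 * a22 ^ p) / t := by rw [← h4]; field_simp
    subst e3 e4
    refine ⟨?_, ?_, ?_, ?_⟩
    · linear_combination d * h1' + b11 ^ p * h1 + b12 ^ p * h2
    · linear_combination d * h2' + b21 ^ p * h1 + b22 ^ p * h2
    · linear_combination t * h3' + b11 ^ p * h3 + b12 ^ p * h4
    · linear_combination t * h4' + b21 ^ p * h3 + b22 ^ p * h4

/-- Over a perfect field, matrices of determinant one may be used without Frobenius twist. -/
theorem rel42zero_of_det_eq_one {F : Type*} [Field F] {p : ℕ} [Fact p.Prime] [CharP F p]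
    (hperf : Function.Surjective fun c : F => c ^ p) {v w : F × F × F × F}
    {b11 b12 b21 b22 : F} (c t : F) (hb : b11 * b22 - b12 * b21 = 1) (ht : t ≠ 0)
    (h1 : w.1 = (v.1 - c * v.2.2.1) * b11 + (v.2.1 - c * v.2.2.2) * b12)
    (h2 : w.2.1 = (v.1 - c * v.2.2.1) * b21 + (v.2.1 - c * v.2.2.2) * b22)
    (h3 : t * w.2.2.1 = v.2.2.1 * b11 + v.2.2.2 * b12)
    (h4 : t * w.2.2.2 = v.2.2.1 * b21 + v.2.2.2 * b22) : rel42zero p v w := by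
  obtain ⟨a11, rfl⟩ := hperf b11
  obtain ⟨a12, rfl⟩ := hperf b12
  obtain ⟨a21, rfl⟩ := hperf b21
  obtain ⟨a22, rfl⟩ := hperf b22
  have hdet : a11 * a22 - a12 * a21 = 1 := by
    apply frobenius_inj F p
    simpa [frobenius_def, sub_pow_char, mul_pow] using hb
  exact (rel42zero_iff p v w).2 ⟨a11, a12, a21, a22, c, t, by simp [hdet], ht,
    by rw [hdet, one_mul]; exact h1, by rw [hdet, one_mul]; exact h2, h3, h4⟩

/-- A nonzero vector of `F²` is moved to `(1, 0)` by a matrix of determinant one. -/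
theorem exists_det_eq_one_map_to_e1 {F : Type*} [Field F] {x y : F} (h : x ≠ 0 ∨ y ≠ 0) :
    ∃ b11 b12 b21 b22 : F, b11 * b22 - b12 * b21 = 1 ∧
      x * b11 + y * b12 = 1 ∧ x * b21 + y * b22 = 0 := by
  rcases h with h | h
  · exact ⟨x⁻¹, 0, -y, x, by simp [h], by simp [h], by ring⟩
  · exact ⟨0, y⁻¹, -y, x, by simp [h], by simp [h], by ring⟩

theorem rel42zero_exists_representative {F : Type*} [Field F] {p : ℕ} [Fact p.Prime]
    [CharP F p] (hperf : Function.Surjective fun c : F => c ^ p) (v : F × F × F × F) :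
    rel42zero p v ((0, 0, 0, 0) : F × F × F × F) ∨
    rel42zero p v ((1, 0, 0, 0) : F × F × F × F) ∨
    rel42zero p v ((0, 0, 1, 0) : F × F × F × F) ∨
    rel42zero p v ((1, 0, 0, 1) : F × F × F × F) := by
  obtain ⟨x, y, z, w⟩ := v
  by_cases hβ : z ≠ 0 ∨ w ≠ 0
  · by_cases hD : x * w - y * z = 0
    · obtain ⟨b11, b12, b21, b22, hb, hb1, hb2⟩ := exists_det_eq_one_map_to_e1 hβ
      obtain ⟨c, hx, hy⟩ : ∃ c, x = c * z ∧ y = c * w := by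
        rcases hβ with h | h
        · refine ⟨x / z, by field_simp, ?_⟩
          field_simp
          linear_combination -hD
        · refine ⟨y / w, ?_, by field_simp⟩
          field_simp
          linear_combination hD
      exact .inr <| .inr <| .inl <| rel42zero_of_det_eq_one hperf c 1 hb one_ne_zero
        (by simp [hx, hy]) (by simp [hx, hy]) (by simp [hb1]) (by simp [hb2])
    · obtain ⟨D, hdef⟩ : ∃ D, D = x * w - y * z := ⟨_, rfl⟩
      rw [← hdef] at hD
      refine .inr <| .inr <| .inr <| rel42zero_of_det_eq_one hperf
        (b11 := w / D) (b12 := -z / D) (b21 := -y) (b22 := x) 0 D ?_ hD ?_ ?_ ?_ ?_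
      · field_simp
        linear_combination -hdef
      · field_simp
        linear_combination hdef
      · ring
      · ring
      · linear_combination hdef
  · obtain ⟨rfl, rfl⟩ : z = 0 ∧ w = 0 := by simpa using hβ
    by_cases hα : x ≠ 0 ∨ y ≠ 0
    · obtain ⟨b11, b12, b21, b22, hb, hb1, hb2⟩ := exists_det_eq_one_map_to_e1 hα
      exact .inr <| .inl <| rel42zero_of_det_eq_one hperf 0 1 hb one_ne_zero
        (by simp [hb1]) (by simp [hb2]) (by simp) (by simp)
    · obtain ⟨rfl, rfl⟩ : x = 0 ∧ y = 0 := by simpa using hα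
      exact .inl <| rel42zero_refl (Fact.out : p.Prime).ne_zero _

/-- Over a perfect field of characteristic `p ≥ 3` the relation `rel42zero` is an
equivalence relation with exactly four classes, represented by `(0,0,0,0)`,
`(1,0,0,0)`, `(0,0,1,0)` and `(1,0,0,1)`. -/
theorem l42_central_kernel_four_orbits
    (F : Type*) [Field F] (p : ℕ) [CharP F p] (hp3 : 3 ≤ p)
    (hperf : Function.Surjective fun c : F => c ^ p) :
    Equivalence (rel42zero (F := F) p) ∧
      (∀ v : F × F × F × F,
        rel42zero p v ((0, 0, 0, 0) : F × F × F × F) ∨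
        rel42zero p v ((1, 0, 0, 0) : F × F × F × F) ∨
        rel42zero p v ((0, 0, 1, 0) : F × F × F × F) ∨
        rel42zero p v ((1, 0, 0, 1) : F × F × F × F)) ∧
      ¬ rel42zero p ((0, 0, 0, 0) : F × F × F × F) ((1, 0, 0, 0) : F × F × F × F) ∧
      ¬ rel42zero p ((0, 0, 0, 0) : F × F × F × F) ((0, 0, 1, 0) : F × F × F × F) ∧
      ¬ rel42zero p ((0, 0, 0, 0) : F × F × F × F) ((1, 0, 0, 1) : F × F × F × F) ∧
      ¬ rel42zero p ((1, 0, 0, 0) : F × F × F × F) ((0, 0, 1, 0) : F × F × F × F) ∧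
      ¬ rel42zero p ((1, 0, 0, 0) : F × F × F × F) ((1, 0, 0, 1) : F × F × F × F) ∧
      ¬ rel42zero p ((0, 0, 1, 0) : F × F × F × F) ((1, 0, 0, 1) : F × F × F × F) := by
  have hp : p.Prime := (CharP.char_is_prime_or_zero F p).resolve_right (by lia)
  have : Fact p.Prime := ⟨hp⟩
  refine ⟨⟨rel42zero_refl hp.ne_zero, rel42zero_symm, rel42zero_trans⟩,
    rel42zero_exists_representative hperf, ?_, ?_, ?_, ?_, ?_, ?_⟩ <;>
    rw [rel42zero_iff] <;>
    rintro ⟨a11, a12, a21, a22, c, t, hd, ht, h1, h2, h3, h4⟩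
  · exact hd (by simpa using h1)
  · exact ht (by simpa using h3)
  · exact hd (by simpa using h1)
  · exact ht (by simpa using h3)
  · exact ht (by simpa using h4)
  · have h : a11 ^ p = 0 := by simpa using h3.symm
    exact hd (by simpa [h] using h1)
end

section
/- Let F be a perfect field of characteristic p ≥ 3. Define a relation ~ on F⁴ by: (α1,α2,β1,β2) ~ (α1',α2',β1',β2') if and only if there exist a11, a12, a21, a22 ∈ F with d := a11a22 − a12a21 ≠ 0 and c1, c2 ∈ F such that α1' = d^{-1}(α1·a11^p + α2·a12^p), α2' = d^{-1}(α1·a21^p + α2·a22^p), β1' = d^{-p}(β1·a11^p + β2·a12^p + c1^p), and β2' = d^{-p}(β1·a21^p + β2·a22^p + c2^p). Then ~ is the orbit relation of a group action on F⁴ with exactly two orbits: (α1,α2,β1,β2) is related to (0,0,0,0) if and only if (α1,α2) = (0,0), and it is related to (0,1,0,0) if and only if (α1,α2) ≠ (0,0). -/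
/-- The orbit relation on tuples `(α1, α2, β1, β2) ∈ F⁴` parametrizing the
`[p]`-nilpotent restricted structures on `L_{4,2}` with `x3^[p] = x4`,
`x4^[p] = 0`, induced by the automorphisms of `L_{4,2}` preserving this
behaviour on the center. -/
def rel42x3 {F : Type*} [Field F] (p : ℕ) (v w : F × F × F × F) : Prop :=
  ∃ a11 a12 a21 a22 c1 c2 : F,
    a11 * a22 - a12 * a21 ≠ 0 ∧
    w.1 = (a11 * a22 - a12 * a21)⁻¹ * (v.1 * a11 ^ p + v.2.1 * a12 ^ p) ∧
    w.2.1 = (a11 * a22 - a12 * a21)⁻¹ * (v.1 * a21 ^ p + v.2.1 * a22 ^ p) ∧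
    w.2.2.1 = ((a11 * a22 - a12 * a21) ^ p)⁻¹ *
        (v.2.2.1 * a11 ^ p + v.2.2.2 * a12 ^ p + c1 ^ p) ∧
    w.2.2.2 = ((a11 * a22 - a12 * a21) ^ p)⁻¹ *
        (v.2.2.1 * a21 ^ p + v.2.2.2 * a22 ^ p + c2 ^ p)

theorem exists_mul_sub_mul_eq_one {F : Type*} [Field F] {s t : F} (h : ¬ (s = 0 ∧ t = 0)) :
    ∃ x y : F, s * y - t * x = 1 := by
  by_cases hs : s = 0
  · have ht : t ≠ 0 := fun ht => h ⟨hs, ht⟩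
    exact ⟨-t⁻¹, 0, by field_simp; ring⟩
  · exact ⟨0, s⁻¹, by field_simp; ring⟩

/-- `SL₂(F)` acts transitively on the nonzero vectors of `F²`. -/
theorem exists_det_eq_one_map {F : Type*} [Field F] {s t u w : F}
    (h : ¬ (s = 0 ∧ t = 0)) (h' : ¬ (u = 0 ∧ w = 0)) :
    ∃ a b c d : F, a * d - b * c = 1 ∧ s * a + t * b = u ∧ s * c + t * d = w := by
  obtain ⟨x, y, hxy⟩ := exists_mul_sub_mul_eq_one h
  obtain ⟨x', y', hxy'⟩ := exists_mul_sub_mul_eq_one h'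
  refine ⟨u * y - x' * t, x' * s - u * x, w * y - y' * t, y' * s - w * x, ?_, ?_, ?_⟩
  · linear_combination (u * y' - w * x') * hxy + hxy'
  · linear_combination u * hxy
  · linear_combination w * hxy

/-- Two tuples are related exactly when their `α`-parts are both zero or both nonzero. -/
theorem rel42x3_iff {F : Type*} [Field F] {p : ℕ} [Fact p.Prime] [CharP F p]
    (hperf : Function.Surjective fun c : F => c ^ p) (v w : F × F × F × F) :
    rel42x3 p v w ↔ ((v.1 = 0 ∧ v.2.1 = 0) ↔ (w.1 = 0 ∧ w.2.1 = 0)) := by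
  have hp : p ≠ 0 := (Fact.out : p.Prime).ne_zero
  obtain ⟨v1, v2, b1, b2⟩ := v
  obtain ⟨w1, w2, e1, e2⟩ := w
  constructor
  · rintro ⟨a, b, c, d, -, -, hd, h1, h2, -, -⟩
    dsimp only at h1 h2 ⊢
    constructor
    · rintro ⟨rfl, rfl⟩
      simp [h1, h2]
    · rintro ⟨rfl, rfl⟩
      have hD : a ^ p * d ^ p - b ^ p * c ^ p ≠ 0 := by
        rw [← mul_pow, ← mul_pow, ← sub_pow_char]
        exact pow_ne_zero p hd
      have k1 := (mul_eq_zero.mp h1.symm).resolve_left (inv_ne_zero hd)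
      have k2 := (mul_eq_zero.mp h2.symm).resolve_left (inv_ne_zero hd)
      constructor
      · refine (mul_eq_zero.mp ?_).resolve_left hD
        linear_combination d ^ p * k1 - b ^ p * k2
      · refine (mul_eq_zero.mp ?_).resolve_left hD
        linear_combination a ^ p * k2 - c ^ p * k1
  · intro h
    dsimp only at h
    obtain ⟨a, b, c, d, hd, h1, h2⟩ : ∃ a b c d : F, a * d - b * c = 1 ∧
        v1 * a ^ p + v2 * b ^ p = w1 ∧ v1 * c ^ p + v2 * d ^ p = w2 := by
      by_cases hv : v1 = 0 ∧ v2 = 0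
      · obtain ⟨rfl, rfl⟩ := h.mp hv
        obtain ⟨rfl, rfl⟩ := hv
        exact ⟨1, 0, 0, 1, by simp, by simp, by simp⟩
      · have hw := mt h.mpr hv
        obtain ⟨s, rfl⟩ := hperf v1
        obtain ⟨t, rfl⟩ := hperf v2
        obtain ⟨u, rfl⟩ := hperf w1
        obtain ⟨z, rfl⟩ := hperf w2
        simp only [pow_eq_zero_iff hp] at hv hw
        obtain ⟨a, b, c, d, hd, h1, h2⟩ := exists_det_eq_one_map hv hw
        refine ⟨a, b, c, d, hd, ?_, ?_⟩
        · simp only [← mul_pow, ← add_pow_char, h1]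
        · simp only [← mul_pow, ← add_pow_char, h2]
    obtain ⟨c1, hc1⟩ := hperf (e1 - (b1 * a ^ p + b2 * b ^ p))
    obtain ⟨c2, hc2⟩ := hperf (e2 - (b1 * c ^ p + b2 * d ^ p))
    dsimp only at hc1 hc2
    exact ⟨a, b, c, d, c1, c2, by simp [hd], by simp [hd, h1], by simp [hd, h2],
      by simp [hd, hc1], by simp [hd, hc2]⟩

/-- Over a perfect field of characteristic `p ≥ 3` the relation `rel42x3` is an
equivalence relation with exactly two classes: that of `(0,0,0,0)`, consisting of
the tuples with `(α1, α2) = (0, 0)`, and that of `(0,1,0,0)`, consisting of the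
tuples with `(α1, α2) ≠ (0, 0)`. -/
theorem l42_x3_to_x4_two_orbits
    (F : Type*) [Field F] (p : ℕ) [CharP F p] (hp3 : 3 ≤ p)
    (hperf : Function.Surjective fun c : F => c ^ p) :
    Equivalence (rel42x3 (F := F) p) ∧
      (∀ v : F × F × F × F,
        rel42x3 p v ((0, 0, 0, 0) : F × F × F × F) ↔ v.1 = 0 ∧ v.2.1 = 0) ∧
      (∀ v : F × F × F × F,
        rel42x3 p v ((0, 1, 0, 0) : F × F × F × F) ↔ ¬ (v.1 = 0 ∧ v.2.1 = 0)) := by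
  have : Fact p.Prime :=
    ⟨(CharP.char_is_prime_or_zero F p).resolve_right (by omega)⟩
  have key := rel42x3_iff (F := F) (p := p) hperf
  refine ⟨⟨fun v => (key v v).mpr Iff.rfl, fun {v w} h => (key w v).mpr ((key v w).mp h).symm,
    fun {u v w} h h' => (key u w).mpr (((key u v).mp h).trans ((key v w).mp h'))⟩,
    fun v => ?_, fun v => ?_⟩
  · simp [key]
  · simp [key]
end

section
/- Let F be a field and let L be the 4-dimensional Lie algebra over F with basis x1, x2, x3, x4 and bracket determined by [x1,x2] = x3 and [x1,x3] = x4, all other brackets of basis vectors being zero. Then a linear map A : L → L is a Lie algebra automorphism of L if and only if there exist a11, a22 ∈ F∖{0} and a12, a13, a14, a23, a24 ∈ F such that A(x1) = a11·x1 + a12·x2 + a13·x3 + a14·x4, A(x2) = a22·x2 + a23·x3 + a24·x4, A(x3) = a11·a22·x3 + a11·a23·x4, and A(x4) = a11²·a22·x4. -/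
theorem LinearMap.apply_fin_four {F M : Type*} [Semiring F] [AddCommMonoid M] [Module F M]
    (A : (Fin 4 → F) →ₗ[F] M) (u : Fin 4 → F) :
    A u = u 0 • A ![1, 0, 0, 0] + u 1 • A ![0, 1, 0, 0] + u 2 • A ![0, 0, 1, 0]
      + u 3 • A ![0, 0, 0, 1] := by
  simp only [← map_smul, ← map_add]
  congr 1
  ext i
  fin_cases i <;> simp

/-- Description of the automorphism group of `L_{4,3}` over an arbitrary field:
a linear map `A` is a Lie algebra automorphism if and only if its matrix has the
prescribed triangular shape. -/
theorem l43_automorphism_description (F : Type*) [Field F]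
    (A : (Fin 4 → F) →ₗ[F] (Fin 4 → F)) :
    (Function.Bijective A ∧ ∀ u v, A (br43 u v) = br43 (A u) (A v)) ↔
      ∃ a11 a22 a12 a13 a14 a23 a24 : F, a11 ≠ 0 ∧ a22 ≠ 0 ∧
        A ![1, 0, 0, 0] = ![a11, a12, a13, a14] ∧
        A ![0, 1, 0, 0] = ![0, a22, a23, a24] ∧
        A ![0, 0, 1, 0] = ![0, 0, a11 * a22, a11 * a23] ∧
        A ![0, 0, 0, 1] = ![0, 0, 0, a11 ^ 2 * a22] := by
  constructor
  · rintro ⟨⟨hinj, -⟩, hbr⟩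
    have h3 : A ![0, 0, 1, 0] = br43 (A ![1, 0, 0, 0]) (A ![0, 1, 0, 0]) := by
      rw [← hbr]; simp [br43]
    have h4 : A ![0, 0, 0, 1] = br43 (A ![1, 0, 0, 0]) (A ![0, 0, 1, 0]) := by
      rw [← hbr]; simp [br43]
    have h0 : br43 (A ![0, 1, 0, 0]) (A ![0, 0, 1, 0]) = 0 := by
      rw [← hbr, ← map_zero A]
      congr 1
      ext i
      fin_cases i <;> simp [br43]
    have hne : A ![0, 0, 0, 1] ≠ 0 := by
      rw [Ne, map_eq_zero_iff A hinj]
      intro h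
      simpa using congrFun h 3
    generalize A ![1, 0, 0, 0] = a at *
    generalize A ![0, 1, 0, 0] = b at *
    rw [h4] at hne ⊢
    rw [h3] at hne h0 ⊢
    have h03 : b 0 = 0 ∨ a 0 * b 1 - a 1 * b 0 = 0 := by simpa [br43] using h0
    have hne' : a 0 ≠ 0 ∧ a 0 * b 1 - a 1 * b 0 ≠ 0 := by
      constructor <;> intro h <;> apply hne <;> simp [br43, h]
    have hb0 : b 0 = 0 := h03.resolve_right hne'.2
    have hb1 : b 1 ≠ 0 := fun h => hne'.2 (by simp [h, hb0])
    refine ⟨a 0, b 1, a 1, a 2, a 3, b 2, b 3, hne'.1, hb1, ?_, ?_, ?_, ?_⟩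
    · ext i; fin_cases i <;> rfl
    · ext i; fin_cases i <;> simp [hb0]
    · simp [br43, hb0]
    · simp [br43, hb0, sq, mul_assoc]
  · rintro ⟨a11, a22, a12, a13, a14, a23, a24, h11, h22, h1, h2, h3, h4⟩
    have hA (u : Fin 4 → F) : A u = ![u 0 * a11, u 0 * a12 + u 1 * a22,
        u 0 * a13 + u 1 * a23 + u 2 * (a11 * a22),
        u 0 * a14 + u 1 * a24 + u 2 * (a11 * a23) + u 3 * (a11 ^ 2 * a22)] := by
      rw [A.apply_fin_four, h1, h2, h3, h4]
      ext i
      fin_cases i <;> simp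
    refine ⟨?_, fun u v => ?_⟩
    · have hinj : Function.Injective A := by
        rw [injective_iff_map_eq_zero]
        intro u hu
        rw [hA] at hu
        have hu0 : u 0 = 0 := by simpa [h11] using congrFun hu 0
        have hu1 : u 1 = 0 := by simpa [hu0, h22] using congrFun hu 1
        have hu2 : u 2 = 0 := by simpa [hu0, hu1, h11, h22] using congrFun hu 2
        have hu3 : u 3 = 0 := by simpa [hu0, hu1, hu2, h11, h22] using congrFun hu 3
        ext i
        fin_cases i <;> assumption
      exact ⟨hinj, LinearMap.injective_iff_surjective.mp hinj⟩
    · rw [hA (br43 u v), hA u, hA v]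
      ext i
      fin_cases i <;> simp [br43] <;> ring
end
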